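/- Assume: P̂ = Σ_{j∈[J]} p_j δ_{ẑ_j} with p_j > 0 and ẑ_j ∈ 𝒵 for all j ∈ [J]; c(z, ẑ) is lower semicontinuous in (z, ẑ) and convex in z; ℓ(θ, z) = max_{i∈[I]} ℓ_i(θ, z), where each ℓ_i : ℝ^m × ℝ^d → ℝ is real-valued, convex and lower semicontinuous in θ, and concave and upper semicontinuous in z; 𝒵 = {z ∈ ℝ^d : f_k(z) ≤ 0 ∀ k ∈ [K]} with each f_k proper, convex and lower semicontinuous; Θ = {θ ∈ ℝ^m : g_l(θ) ≤ 0 ∀ l ∈ [L]} with each g_l proper, convex and lower semicontinuous; for every j ∈ [J], ẑ_j lies in the relative interior of dom c(·, ẑ_j) and of dom f_k for every k ∈ [K], and f_k(ẑ_j) < 0 for every k ∈ [K] such that f_k is nonlinear; and ε > 0. Then inf_{θ∈Θ} sup_{Q∈B_ε(P̂)} ∫ ℓ(θ, z) dQ(z) equals the infimum of λε + Σ_{j∈[J]} p_j s_j over all θ ∈ Θ, λ ≥ 0, τ_{ijk} ≥ 0, s_j ∈ ℝ, and ζ^ℓ_{ij}, ζ^c_{ij}, ζ^f_{ijk} ∈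 ℝ^d (i ∈ [I], j ∈ [J], k ∈ [K]) satisfying, for all i ∈ [I] and j ∈ [J], (−ℓ_i)^{*2}(θ, ζ^ℓ_{ij}) + λ c^{*1}(ζ^c_{ij}/λ, ẑ_j) + Σ_{k∈[K]} τ_{ijk} f_k^{*}(ζ^f_{ijk}/τ_{ijk}) ≤ s_j and ζ^ℓ_{ij} + ζ^c_{ij} + Σ_{k∈[K]} ζ^f_{ijk} = 0. -/

import Mathlib

open MeasureTheory ENNReal Set Filter Topology

noncomputable section

/-- The set of couplings of two measures. -/
def couplings {α : Type*} [MeasurableSpace α] (Q P : Measure α) : Set (Measure (α × α)) :=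
  {π | π.map Prod.fst = Q ∧ π.map Prod.snd = P}

/-- The optimal transport discrepancy `d_c(Q, P) = inf_π ∫ c dπ`. -/
def OTDiscrepancy {α : Type*} [MeasurableSpace α] (c : α → α → ℝ≥0∞) (Q P : Measure α) :
    ℝ≥0∞ :=
  ⨅ π ∈ couplings Q P, ∫⁻ p, c p.1 p.2 ∂π

/-- The optimal transport ambiguity set `B_ε(P) = {Q : d_c(Q, P) ≤ ε}`. -/
def ambiguitySet {α : Type*} [MeasurableSpace α] (c : α → α → ℝ≥0∞)
    (P : ProbabilityMeasure α) (ε : ℝ) : Set (ProbabilityMeasure α) :=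
  {Q | OTDiscrepancy c Q.toMeasure P.toMeasure ≤ ENNReal.ofReal ε}

/-- The `[0,∞]`-valued positive part of an extended real number. -/
def erealPos (x : EReal) : ℝ≥0∞ := if x = ⊤ then ⊤ else ENNReal.ofReal x.toReal

/-- The `(−∞,∞]`-valued integral of a `(−∞,∞]`-valued function. -/
def eint {α : Type*} [MeasurableSpace α] (μ : Measure α) (f : α → EReal) : EReal :=
  ((∫⁻ a, erealPos (f a) ∂μ : ℝ≥0∞) : EReal) - ((∫⁻ a, erealPos (-(f a)) ∂μ : ℝ≥0∞) : EReal)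

/-- The inner product `⟨x, y⟩ = Σ_i x_i y_i` on `ℝ^n`. -/
def dotp {n : ℕ} (x y : Fin n → ℝ) : ℝ := ∑ i, x i * y i

/-- The convex conjugate `f^*(y) = sup_x ⟨y, x⟩ − f(x)` of an extended-real-valued
function on `ℝ^n`. -/
def conjE {n : ℕ} (f : (Fin n → ℝ) → EReal) (y : Fin n → ℝ) : EReal :=
  ⨆ x : Fin n → ℝ, ((dotp y x : ℝ) : EReal) - f x

/-- The perspective `t f(x/t)` of an extended-real-valued function, defined for `t > 0`
as `t f(x/t)` and for `t ≤ 0` (i.e. `t = 0`) as the support function of `dom f^*`. -/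
def perspE {n : ℕ} (f : (Fin n → ℝ) → EReal) (x : Fin n → ℝ) (t : ℝ) : EReal :=
  if 0 < t then (t : EReal) * f (t⁻¹ • x)
  else ⨆ u ∈ {u : Fin n → ℝ | conjE f u ≠ ⊤}, ((dotp x u : ℝ) : EReal)

/-- A function into `(−∞,∞]` is proper if it never takes the value `−∞` and is not
identically `+∞`. -/
def ProperE {n : ℕ} (f : (Fin n → ℝ) → EReal) : Prop :=
  (∀ x, f x ≠ ⊥) ∧ (∃ x, f x ≠ ⊤)

/-- (Extended-real-valued) convexity. -/
def ConvexE {n : ℕ} (f : (Fin n → ℝ) → EReal) : Prop :=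
  ∀ x y : Fin n → ℝ, ∀ a b : ℝ, 0 ≤ a → 0 ≤ b → a + b = 1 →
    f (a • x + b • y) ≤ (a : EReal) * f x + (b : EReal) * f y

/-- The point `x` lies in `D`, and every segment in `D` ending at `x` can be prolonged beyond `x`
within `D`: the algebraic form of membership in the relative interior of a convex set. -/
def IsRelCore {V : Type*} [AddCommGroup V] [Module ℝ V] (D : Set V) (x : V) : Prop :=
  x ∈ D ∧ ∀ y ∈ D, ∃ δ : ℝ, 0 < δ ∧ x + δ • (x - y) ∈ D

lemma isRelCore_of_mem_intrinsicInterior {n : ℕ} {D : Set (Fin n → ℝ)} {x : Fin n → ℝ}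
    (hx : x ∈ intrinsicInterior ℝ D) : IsRelCore D x := by
  refine ⟨intrinsicInterior_subset hx, fun y hy => ?_⟩
  obtain ⟨x', hx', rfl⟩ := mem_intrinsicInterior.1 hx
  let y' : affineSpan ℝ D := ⟨y, subset_affineSpan ℝ D hy⟩
  have key : ∀ δ : ℝ, (x' : Fin n → ℝ) + δ • ((x' : Fin n → ℝ) - y) ∈ affineSpan ℝ D := by
    intro δ
    have := AffineMap.lineMap_mem (-δ) x'.2 y'.2
    rw [AffineMap.lineMap_apply] at this
    convert this using 1
    simp only [vsub_eq_sub, vadd_eq_add, y']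
    module
  let g : ℝ → affineSpan ℝ D := fun δ => ⟨_, key δ⟩
  have hg : Continuous g := by
    refine Continuous.subtype_mk ?_ _
    fun_prop
  have hg0 : g 0 = x' := by
    apply Subtype.ext
    simp [g]
  have hev : ∀ᶠ δ in 𝓝 (0 : ℝ), g δ ∈ interior ((↑) ⁻¹' D : Set (affineSpan ℝ D)) := by
    apply hg.continuousAt.eventually_mem
    rw [hg0]
    exact isOpen_interior.mem_nhds hx'
  obtain ⟨δ, hδ, hpos⟩ :=
    ((hev.filter_mono nhdsWithin_le_nhds).and (self_mem_nhdsWithin (s := Ioi (0 : ℝ)))).exists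
  have hmem : g δ ∈ ((↑) ⁻¹' D : Set (affineSpan ℝ D)) := interior_subset hδ
  exact ⟨δ, hpos, hmem⟩

section Multipliers

variable {V : Type*} [AddCommGroup V] [Module ℝ V]

lemma affineMap_reflect (b : V →ᵃ[ℝ] ℝ) (x y : V) (δ : ℝ) :
    b (x + δ • (x - y)) = b x + δ * (b x - b y) := by
  have : b.linear (x - y) = b x - b y := by
    simpa using b.linearMap_vsub x y
  have h2 := b.map_vadd x (δ • (x - y))
  simp only [vadd_eq_add, map_smul, this, smul_eq_mul] at h2
  rw [add_comm, h2]; ring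

lemma affineMap_sum_smul_apply {ι : Type*} (S : Finset ι) (σ : ι → ℝ) (b : ι → V →ᵃ[ℝ] ℝ) (z : V) :
    (∑ k ∈ S, σ k • b k : V →ᵃ[ℝ] ℝ) z = ∑ k ∈ S, σ k * b k z := by
  classical
  induction S using Finset.induction_on with
  | empty => simp
  | insert i S hi ih => simp [Finset.sum_insert hi, ih]

lemma IsRelCore.inter_affine_eq_zero {D : Set V} {x : V} (hx : IsRelCore D x) (b : V →ᵃ[ℝ] ℝ)
    (hb : b x = 0) : IsRelCore (D ∩ {z | b z = 0}) x := by
  refine ⟨⟨hx.1, hb⟩, fun y hy => ?_⟩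
  obtain ⟨δ, hδ, hmem⟩ := hx.2 y hy.1
  refine ⟨δ, hδ, hmem, ?_⟩
  have hy2 : b y = 0 := hy.2
  change b _ = 0
  rw [affineMap_reflect, hb, hy2]
  ring

lemma convexOn_affineMap {D : Set V} (hD : Convex ℝ D) (b : V →ᵃ[ℝ] ℝ) : ConvexOn ℝ D b :=
  ⟨hD, fun _ _ _ _ _ _ _ _ hab => (Convex.combo_affine_apply hab).le⟩

lemma exists_multiplier_of_cross_nonneg {α : Type*} {S : Set α} {g h : α → ℝ}
    (hcross : ∀ a ∈ S, ∀ b ∈ S, g a < 0 → 0 < g b → 0 ≤ g b * h a - g a * h b)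
    (hneg : ∀ a ∈ S, g a ≤ 0 → 0 ≤ h a) (hex : ∃ a ∈ S, g a < 0) :
    ∃ τ : ℝ, 0 ≤ τ ∧ ∀ a ∈ S, 0 ≤ h a + τ * g a := by
  obtain ⟨a₀, ha₀, hga₀⟩ := hex
  let R : Set ℝ := insert 0 ((fun b => -h b / g b) '' {b ∈ S | 0 < g b})
  have hub : ∀ a ∈ S, g a < 0 → ∀ r ∈ R, r ≤ h a / -g a := by
    rintro a ha hga r (rfl | ⟨b, ⟨hb, hgb⟩, rfl⟩)
    · exact div_nonneg (hneg a ha hga.le) (by linarith)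
    · rw [div_le_div_iff₀ hgb (by linarith)]
      linarith [hcross a ha b hb hga hgb]
  have hbdd : BddAbove R := ⟨_, hub a₀ ha₀ hga₀⟩
  have h0 : 0 ≤ sSup R := le_csSup hbdd (mem_insert _ _)
  refine ⟨sSup R, h0, fun a ha => ?_⟩
  rcases lt_trichotomy (g a) 0 with hga | hga | hga
  · have := csSup_le (insert_nonempty _ _) (hub a ha hga)
    rw [le_div_iff₀ (by linarith)] at this
    linarith
  · simpa [hga] using hneg a ha hga.le
  · have : -h a / g a ≤ sSup R := le_csSup hbdd (mem_insert_of_mem _ ⟨a, ⟨ha, hga⟩, rfl⟩)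
    rw [div_le_iff₀ hga] at this
    linarith

lemma exists_signed_multiplier_of_cross_nonneg {α : Type*} {S : Set α} {g h : α → ℝ}
    (hcross : ∀ a ∈ S, ∀ b ∈ S, g a < 0 → 0 < g b → 0 ≤ g b * h a - g a * h b)
    (hzero : ∀ a ∈ S, g a = 0 → 0 ≤ h a) (hex : ∃ a ∈ S, g a < 0) (hex' : ∃ a ∈ S, 0 < g a) :
    ∃ τ : ℝ, ∀ a ∈ S, 0 ≤ h a + τ * g a := by
  obtain ⟨a₀, ha₀, hga₀⟩ := hex
  obtain ⟨b₀, hb₀, hgb₀⟩ := hex'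
  let R : Set ℝ := (fun b => -h b / g b) '' {b ∈ S | 0 < g b}
  have hub : ∀ a ∈ S, g a < 0 → ∀ r ∈ R, r ≤ h a / -g a := by
    rintro a ha hga r ⟨b, ⟨hb, hgb⟩, rfl⟩
    rw [div_le_div_iff₀ hgb (by linarith)]
    linarith [hcross a ha b hb hga hgb]
  have hbdd : BddAbove R := ⟨_, hub a₀ ha₀ hga₀⟩
  have hne : R.Nonempty := ⟨_, b₀, ⟨hb₀, hgb₀⟩, rfl⟩
  refine ⟨sSup R, fun a ha => ?_⟩
  rcases lt_trichotomy (g a) 0 with hga | hga | hga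
  · have := csSup_le hne (hub a ha hga)
    rw [le_div_iff₀ (by linarith)] at this
    linarith
  · simpa [hga] using hzero a ha hga
  · have : -h a / g a ≤ sSup R := le_csSup hbdd ⟨a, ⟨ha, hga⟩, rfl⟩
    rw [div_le_iff₀ hga] at this
    linarith

lemma ConvexOn.cross_nonneg {D : Set V} {h : V → ℝ} (hh : ConvexOn ℝ D h) {a b : V} (ha : a ∈ D)
    (hb : b ∈ D) {s t : ℝ} (hs : s < 0) (ht : 0 < t)
    (hw : 0 ≤ h ((t / (t - s)) • a + (-s / (t - s)) • b)) : 0 ≤ t * h a - s * h b := by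
  have hts : 0 < t - s := by linarith
  have h1 := hh.2 ha hb (div_nonneg ht.le hts.le) (div_nonneg (neg_nonneg.2 hs.le) hts.le)
    (by field_simp; ring)
  have h2 : 0 ≤ (t / (t - s)) * h a + (-s / (t - s)) * h b := hw.trans h1
  have h3 : (t - s) * ((t / (t - s)) * h a + (-s / (t - s)) * h b) = t * h a - s * h b := by
    field_simp
    ring
  rw [← h3]
  exact mul_nonneg hts.le h2

lemma ConvexOn.exists_multiplier {D : Set V} {H g : V → ℝ} (hH : ConvexOn ℝ D H)
    (hg : ConvexOn ℝ D g) (hnonneg : ∀ z ∈ D, g z ≤ 0 → 0 ≤ H z) (hex : ∃ z ∈ D, g z < 0) :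
    ∃ τ : ℝ, 0 ≤ τ ∧ ∀ z ∈ D, 0 ≤ H z + τ * g z := by
  refine exists_multiplier_of_cross_nonneg (fun a ha b hb hga hgb => ?_) hnonneg hex
  have hts : 0 < g b - g a := by linarith
  have hs0 : 0 ≤ g b / (g b - g a) := div_nonneg hgb.le hts.le
  have ht0 : 0 ≤ -g a / (g b - g a) := div_nonneg (by linarith) hts.le
  have hst : g b / (g b - g a) + -g a / (g b - g a) = 1 := by field_simp; ring
  refine hH.cross_nonneg ha hb hga hgb (hnonneg _ (hH.1 ha hb hs0 ht0 hst) ?_)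
  refine (hg.2 ha hb hs0 ht0 hst).trans_eq ?_
  simp only [smul_eq_mul]
  field_simp
  ring

lemma ConvexOn.exists_multipliers_of_slater {ι : Type*} {g : ι → V → ℝ} {x : V} (S : Finset ι) :
    ∀ {D : Set V} {H : V → ℝ}, x ∈ D → ConvexOn ℝ D H → (∀ k ∈ S, ConvexOn ℝ D (g k)) →
      (∀ k ∈ S, g k x < 0) → (∀ z ∈ D, (∀ k ∈ S, g k z ≤ 0) → 0 ≤ H z) →
      ∃ τ : ι → ℝ, (∀ k, 0 ≤ τ k) ∧ ∀ z ∈ D, 0 ≤ H z + ∑ k ∈ S, τ k * g k z := by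
  classical
  induction S using Finset.induction_on with
  | empty =>
    intro D H hx hH _ _ hn
    exact ⟨0, fun _ => le_rfl, fun z hz => by simpa using hn z hz (by simp)⟩
  | insert i S hi ih =>
    intro D H hx hH hg hgx hn
    let D₀ : Set V := {z ∈ D | ∀ k ∈ S, g k z ≤ 0}
    have hD₀ : Convex ℝ D₀ := by
      intro a ha b hb s t hs ht hst
      refine ⟨hH.1 ha.1 hb.1 hs ht hst, fun k hk => ?_⟩
      refine ((hg k (Finset.mem_insert_of_mem hk)).2 ha.1 hb.1 hs ht hst).trans ?_
      have h1 := mul_nonneg hs (neg_nonneg.2 (ha.2 k hk))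
      have h2 := mul_nonneg ht (neg_nonneg.2 (hb.2 k hk))
      simp only [smul_eq_mul]
      linarith
    obtain ⟨τ, hτ, h1⟩ := (hH.subset (sep_subset _ _) hD₀).exists_multiplier
      ((hg i (Finset.mem_insert_self _ _)).subset (sep_subset _ _) hD₀)
      (fun z hz hzi => hn z hz.1 (by
        intro k hk
        rcases Finset.mem_insert.1 hk with rfl | hk
        · exact hzi
        · exact hz.2 k hk))
      ⟨x, ⟨hx, fun k hk => (hgx k (Finset.mem_insert_of_mem hk)).le⟩,
        hgx i (Finset.mem_insert_self _ _)⟩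
    obtain ⟨σ, hσ, h2⟩ := ih (H := fun z => H z + τ * g i z) hx
      (hH.add ((hg i (Finset.mem_insert_self _ _)).smul hτ))
      (fun k hk => hg k (Finset.mem_insert_of_mem hk))
      (fun k hk => hgx k (Finset.mem_insert_of_mem hk)) (fun z hz hzk => h1 z ⟨hz, hzk⟩)
    refine ⟨Function.update σ i τ, fun k => ?_, fun z hz => ?_⟩
    · rcases eq_or_ne k i with rfl | hki
      · simpa using hτ
      · simpa [hki] using hσ k
    · rw [Finset.sum_insert hi, Finset.sum_congr rfl (g := fun k => σ k * g k z)]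
      · simpa [add_assoc] using h2 z hz
      · intro k hk
        rw [Function.update_of_ne (ne_of_mem_of_not_mem hk hi)]

lemma ConvexOn.exists_signed_multiplier {D : Set V} {H : V → ℝ} {x : V} (hH : ConvexOn ℝ D H)
    (hx : IsRelCore D x) {b : V →ᵃ[ℝ] ℝ} (hb : b x = 0)
    (hnonneg : ∀ z ∈ D, b z = 0 → 0 ≤ H z) : ∃ σ : ℝ, ∀ z ∈ D, 0 ≤ H z + σ * b z := by
  by_cases hall : ∀ z ∈ D, b z = 0
  · exact ⟨0, fun z hz => by simpa using hnonneg z hz (hall z hz)⟩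
  push Not at hall
  obtain ⟨y, hy, hby⟩ := hall
  obtain ⟨δ, hδ, hmem⟩ := hx.2 y hy
  have hr : b (x + δ • (x - y)) = -(δ * b y) := by rw [affineMap_reflect, hb]; ring
  have hboth : (∃ z ∈ D, b z < 0) ∧ ∃ z ∈ D, 0 < b z := by
    rcases lt_or_gt_of_ne hby with h | h
    · refine ⟨⟨y, hy, h⟩, _, hmem, ?_⟩
      rw [hr]
      linarith [mul_neg_of_pos_of_neg hδ h]
    · refine ⟨⟨_, hmem, ?_⟩, y, hy, h⟩
      rw [hr]
      linarith [mul_pos hδ h]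
  refine exists_signed_multiplier_of_cross_nonneg (fun u hu w hw hgu hgw => ?_) hnonneg
    hboth.1 hboth.2
  have hts : 0 < b w - b u := by linarith
  have hs0 : 0 ≤ b w / (b w - b u) := div_nonneg hgw.le hts.le
  have ht0 : 0 ≤ -b u / (b w - b u) := div_nonneg (by linarith) hts.le
  have hst : b w / (b w - b u) + -b u / (b w - b u) = 1 := by field_simp; ring
  refine hH.cross_nonneg hu hw hgu hgw (hnonneg _ (hH.1 hu hw hs0 ht0 hst) ?_)
  rw [Convex.combo_affine_apply hst]
  simp only [smul_eq_mul]
  field_simp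
  ring

lemma convex_inter_affine_eq_zero {D : Set V} (hD : Convex ℝ D) (b : V →ᵃ[ℝ] ℝ) :
    Convex ℝ (D ∩ {z | b z = 0}) := by
  intro u hu w hw s t hs ht hst
  have h1 : b u = 0 := hu.2
  have h2 : b w = 0 := hw.2
  refine ⟨hD hu.1 hw.1 hs ht hst, ?_⟩
  simp [Convex.combo_affine_apply hst, h1, h2]

lemma ConvexOn.exists_signed_multipliers {ι : Type*} {b : ι → V →ᵃ[ℝ] ℝ} {x : V} (S : Finset ι)
    (hb : ∀ k ∈ S, b k x = 0) :
    ∀ {D : Set V} {H : V → ℝ}, IsRelCore D x → ConvexOn ℝ D H →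
      (∀ z ∈ D, (∀ k ∈ S, b k z = 0) → 0 ≤ H z) →
      ∃ σ : ι → ℝ, ∀ z ∈ D, 0 ≤ H z + ∑ k ∈ S, σ k * b k z := by
  classical
  induction S using Finset.induction_on with
  | empty =>
    intro D H _ _ hn
    exact ⟨0, fun z hz => by simpa using hn z hz (by simp)⟩
  | insert i S hi ih =>
    intro D H hx hH hn
    have hbi := hb i (Finset.mem_insert_self _ _)
    obtain ⟨σ, h1⟩ := ih (fun k hk => hb k (Finset.mem_insert_of_mem hk))
      (hx.inter_affine_eq_zero (b i) hbi)
      (hH.subset inter_subset_left (convex_inter_affine_eq_zero hH.1 (b i)))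
      (fun z hz hzk => hn z hz.1 (by
        intro k hk
        rcases Finset.mem_insert.1 hk with rfl | hk
        · exact hz.2
        · exact hzk k hk))
    have hconv : ConvexOn ℝ D (fun z => H z + ∑ k ∈ S, σ k * b k z) := by
      have h3 : ConvexOn ℝ D (∑ k ∈ S, σ k • b k : V →ᵃ[ℝ] ℝ) := convexOn_affineMap hH.1 _
      exact (hH.add h3).congr fun z _ => by simp [affineMap_sum_smul_apply]
    obtain ⟨τ, h2⟩ := hconv.exists_signed_multiplier hx hbi (fun z hz hzi => h1 z ⟨hz, hzi⟩)
    refine ⟨Function.update σ i τ, fun z hz => ?_⟩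
    rw [Finset.sum_insert hi, Finset.sum_congr rfl (g := fun k => σ k * b k z)]
    · have := h2 z hz
      simp only [Function.update_self]
      linarith
    · intro k hk
      rw [Function.update_of_ne (ne_of_mem_of_not_mem hk hi)]

lemma ConvexOn.exists_multipliers_of_affine {ι : Type*} {a : ι → V →ᵃ[ℝ] ℝ} {x : V}
    (S : Finset ι) (ha : ∀ k ∈ S, a k x ≤ 0) :
    ∀ {D : Set V} {H : V → ℝ}, IsRelCore D x → ConvexOn ℝ D H →
      (∀ z ∈ D, (∀ k ∈ S, a k z ≤ 0) → 0 ≤ H z) →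
      ∃ τ : ι → ℝ, (∀ k, 0 ≤ τ k) ∧ ∀ z ∈ D, 0 ≤ H z + ∑ k ∈ S, τ k * a k z := by
  classical
  induction S using Finset.induction_on with
  | empty =>
    intro D H _ _ hn
    exact ⟨0, fun _ => le_rfl, fun z hz => by simpa using hn z hz (by simp)⟩
  | insert i S hi ih =>
    intro D H hx hH hn
    have haS : ∀ k ∈ S, a k x ≤ 0 := fun k hk => ha k (Finset.mem_insert_of_mem hk)
    have hai := ha i (Finset.mem_insert_self _ _)
    have hins : ∀ z ∈ D, a i z ≤ 0 → (∀ k ∈ S, a k z ≤ 0) → 0 ≤ H z := fun z hz hzi hzk =>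
      hn z hz (by
        intro k hk
        rcases Finset.mem_insert.1 hk with rfl | hk
        · exact hzi
        · exact hzk k hk)
    -- it is enough to find the multiplier of `a i` and the remaining ones separately
    suffices h : ∃ (τ : ℝ) (σ : ι → ℝ), 0 ≤ τ ∧ (∀ k, 0 ≤ σ k) ∧
        ∀ z ∈ D, 0 ≤ H z + τ * a i z + ∑ k ∈ S, σ k * a k z by
      obtain ⟨τ, σ, hτ, hσ, h⟩ := h
      refine ⟨Function.update σ i τ, fun k => ?_, fun z hz => ?_⟩
      · rcases eq_or_ne k i with rfl | hki
        · simpa using hτ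
        · simpa [hki] using hσ k
      · rw [Finset.sum_insert hi, Finset.sum_congr rfl (g := fun k => σ k * a k z)]
        · simpa [add_assoc] using h z hz
        · intro k hk
          rw [Function.update_of_ne (ne_of_mem_of_not_mem hk hi)]
    let D₀ : Set V := {z ∈ D | ∀ k ∈ S, a k z ≤ 0}
    have hD₀ : Convex ℝ D₀ := by
      intro u hu w hw s t hs ht hst
      refine ⟨hH.1 hu.1 hw.1 hs ht hst, fun k hk => ?_⟩
      have h1 := mul_nonneg hs (neg_nonneg.2 (hu.2 k hk))
      have h2 := mul_nonneg ht (neg_nonneg.2 (hw.2 k hk))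
      rw [Convex.combo_affine_apply hst]
      simp only [smul_eq_mul]
      linarith
    by_cases hex : ∃ z ∈ D₀, a i z < 0
    · obtain ⟨τ, hτ, h1⟩ := (hH.subset (sep_subset _ _) hD₀).exists_multiplier
        (convexOn_affineMap hD₀ (a i)) (fun z hz hzi => hins z hz.1 hzi hz.2) hex
      obtain ⟨σ, hσ, h2⟩ := ih haS (H := fun z => H z + τ * a i z) hx
        (hH.add ((convexOn_affineMap hH.1 (a i)).smul hτ)) (fun z hz hzk => h1 z ⟨hz, hzk⟩)
      exact ⟨τ, σ, hτ, hσ, h2⟩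
    · push Not at hex
      obtain ⟨μ, hμ, h1⟩ := ih haS hx (convexOn_affineMap hH.1 (a i))
        (fun z hz hzk => hex z ⟨hz, hzk⟩)
      have haix : a i x = 0 := le_antisymm hai (hex x ⟨hx.1, haS⟩)
      let e : V →ᵃ[ℝ] ℝ := a i + ∑ k ∈ S, μ k • a k
      have he : ∀ z, e z = a i z + ∑ k ∈ S, μ k * a k z := fun z => by
        simp [e, affineMap_sum_smul_apply]
      have hex0 : e x = 0 := by
        refine le_antisymm ?_ ((h1 x hx.1).trans_eq (he x).symm)
        rw [he, haix, zero_add]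
        exact Finset.sum_nonpos fun k hk => mul_nonpos_of_nonneg_of_nonpos (hμ k) (haS k hk)
      have he0 : ∀ z ∈ D, e z = 0 := by
        intro z hz
        obtain ⟨δ, hδ, hmem⟩ := hx.2 z hz
        have h2 := h1 _ hmem
        rw [← he, affineMap_reflect, hex0] at h2
        have h3 : 0 ≤ e z := (h1 z hz).trans_eq (he z).symm
        nlinarith
      obtain ⟨ρ, hρ, h2⟩ := ih haS (hx.inter_affine_eq_zero (a i) haix)
        (hH.subset inter_subset_left (convex_inter_affine_eq_zero hH.1 (a i)))
        (fun z hz hzk => hins z hz.1 (le_of_eq hz.2) hzk)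
      have hconv : ConvexOn ℝ D (fun z => H z + ∑ k ∈ S, ρ k * a k z) := by
        have h3 : ConvexOn ℝ D (∑ k ∈ S, ρ k • a k : V →ᵃ[ℝ] ℝ) := convexOn_affineMap hH.1 _
        exact (hH.add h3).congr fun z _ => by simp [affineMap_sum_smul_apply]
      obtain ⟨σ, h3⟩ := hconv.exists_signed_multiplier hx haix (fun z hz hzi => h2 z ⟨hz, hzi⟩)
      rcases le_total 0 σ with hσ | hσ
      · exact ⟨σ, ρ, hσ, hρ, fun z hz => by linarith [h3 z hz]⟩
      · refine ⟨0, fun k => ρ k - σ * μ k, le_rfl,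
          fun k => by nlinarith [hρ k, mul_nonneg (neg_nonneg.2 hσ) (hμ k)], fun z hz => ?_⟩
        have h4 := h3 z hz
        have h5 := he0 z hz
        rw [he] at h5
        have h6 : ∑ k ∈ S, (ρ k - σ * μ k) * a k z
            = ∑ k ∈ S, ρ k * a k z - σ * ∑ k ∈ S, μ k * a k z := by
          rw [Finset.mul_sum, ← Finset.sum_sub_distrib]
          exact Finset.sum_congr rfl fun k _ => by ring
        have h7 : ∑ k ∈ S, μ k * a k z = -a i z := by linarith
        rw [h6, h7]
        linarith

end Multipliers

section RelCore

variable {V : Type*} [AddCommGroup V] [Module ℝ V]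

lemma IsRelCore.eventually_mem {D : Set V} {x y : V} (hx : IsRelCore D x) (hD : Convex ℝ D)
    (hy : y ∈ D) : ∀ᶠ t : ℝ in 𝓝[>] 0, x + t • (x - y) ∈ D := by
  obtain ⟨δ, hδ, hmem⟩ := hx.2 y hy
  filter_upwards [Ioo_mem_nhdsGT hδ] with t ht
  have h1 : x + t • (x - y) = (1 - t / δ) • x + (t / δ) • (x + δ • (x - y)) := by
    have h2 : (t / δ) • δ • (x - y) = t • (x - y) := by
      rw [smul_smul, div_mul_cancel₀ _ hδ.ne']
    rw [smul_add, h2]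
    module
  rw [h1]
  refine hD hx.1 hmem ?_ (div_nonneg ht.1.le hδ.le) (by ring)
  rw [sub_nonneg, div_le_one hδ]
  exact ht.2.le

lemma IsRelCore.of_eventually {D : Set V} {x : V} (hx : x ∈ D)
    (h : ∀ y ∈ D, ∀ᶠ t : ℝ in 𝓝[>] 0, x + t • (x - y) ∈ D) : IsRelCore D x := by
  refine ⟨hx, fun y hy => ?_⟩
  obtain ⟨t, ht, hpos⟩ := ((h y hy).and (self_mem_nhdsWithin (s := Ioi (0 : ℝ)))).exists
  exact ⟨t, hpos, ht⟩

lemma IsRelCore.univ (x : V) : IsRelCore (Set.univ : Set V) x :=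
  ⟨mem_univ _, fun _ _ => ⟨1, one_pos, mem_univ _⟩⟩

lemma IsRelCore.iInter {ι : Type*} [Finite ι] {D : ι → Set V} {x : V}
    (hx : ∀ i, IsRelCore (D i) x) (hD : ∀ i, Convex ℝ (D i)) : IsRelCore (⋂ i, D i) x := by
  refine .of_eventually (mem_iInter.2 fun i => (hx i).1) fun y hy => ?_
  have := eventually_all.2 fun i => (hx i).eventually_mem (hD i) (mem_iInter.1 hy i)
  filter_upwards [this] with t ht using mem_iInter.2 ht

lemma IsRelCore.inter {D D' : Set V} {x : V} (hx : IsRelCore D x) (hx' : IsRelCore D' x)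
    (hD : Convex ℝ D) (hD' : Convex ℝ D') : IsRelCore (D ∩ D') x := by
  refine .of_eventually ⟨hx.1, hx'.1⟩ fun y hy => ?_
  filter_upwards [hx.eventually_mem hD hy.1, hx'.eventually_mem hD' hy.2] with t h1 h2
    using ⟨h1, h2⟩

lemma IsRelCore.pi {ι : Type*} [Finite ι] {D : ι → Set V} {x : V}
    (hx : ∀ i, IsRelCore (D i) x) (hD : ∀ i, Convex ℝ (D i)) :
    IsRelCore (Set.univ.pi D) (fun _ => x) := by
  refine .of_eventually (fun i _ => (hx i).1) fun y hy => ?_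
  have := eventually_all.2 fun i => (hx i).eventually_mem (hD i) (hy i (mem_univ i))
  filter_upwards [this] with t ht using fun i _ => ht i

end RelCore

lemma convexOn_finset_sum {V ι : Type*} [AddCommGroup V] [Module ℝ V] {D : Set V}
    (hD : Convex ℝ D) (S : Finset ι) {h : ι → V → ℝ} (hh : ∀ i ∈ S, ConvexOn ℝ D (h i)) :
    ConvexOn ℝ D (fun z => ∑ i ∈ S, h i z) := by
  classical
  induction S using Finset.induction_on with
  | empty => simpa using convexOn_const (0 : ℝ) hD
  | insert i S hi ih =>
    simp only [Finset.sum_insert hi]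
    exact (hh i (Finset.mem_insert_self _ _)).add
      (ih fun k hk => hh k (Finset.mem_insert_of_mem hk))

lemma exists_sum_le_of_forall_sum_le {ι α : Type*} [Fintype ι] {S : ι → Set α} {φ : ι → α → ℝ}
    {B : ℝ} (hS : ∀ i, (S i).Nonempty) (h : ∀ z : ι → α, (∀ i, z i ∈ S i) → ∑ i, φ i (z i) ≤ B) :
    ∃ b : ι → ℝ, ∑ i, b i ≤ B ∧ ∀ i, ∀ z ∈ S i, φ i z ≤ b i := by
  classical
  choose x hx using hS
  have hbdd : ∀ i, BddAbove (φ i '' S i) := by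
    intro i
    refine ⟨B - ∑ k ∈ Finset.univ.erase i, φ k (x k), ?_⟩
    rintro _ ⟨z, hz, rfl⟩
    have h1 := h (Function.update x i z) (fun k => by
      rcases eq_or_ne k i with rfl | hk
      · simpa using hz
      · simpa [hk] using hx k)
    rw [← Finset.add_sum_erase _ _ (Finset.mem_univ i), Finset.sum_congr rfl
      (g := fun k => φ k (x k)) (fun k hk => by
        rw [Function.update_of_ne (Finset.ne_of_mem_erase hk)])] at h1
    simp only [Function.update_self] at h1
    linarith
  refine ⟨fun i => sSup (φ i '' S i), ?_, fun i z hz => le_csSup (hbdd i) ⟨z, hz, rfl⟩⟩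
  refine le_of_forall_pos_le_add fun η hη => ?_
  have hN : 0 < (Fintype.card ι : ℝ) + 1 := by positivity
  have hnear : ∀ i, ∃ z ∈ S i, sSup (φ i '' S i) - η / (Fintype.card ι + 1) < φ i z := by
    intro i
    obtain ⟨_, ⟨z, hz, rfl⟩, hlt⟩ := exists_lt_of_lt_csSup (s := φ i '' S i)
      ⟨_, x i, hx i, rfl⟩ (sub_lt_self _ (div_pos hη hN))
    exact ⟨z, hz, hlt⟩
  choose z hz hlt using hnear
  calc ∑ i, sSup (φ i '' S i) ≤ ∑ i, (φ i (z i) + η / (Fintype.card ι + 1)) :=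
        Finset.sum_le_sum fun i _ => by linarith [hlt i]
    _ = ∑ i, φ i (z i) + Fintype.card ι * (η / (Fintype.card ι + 1)) := by
        simp [Finset.sum_add_distrib]
    _ ≤ B + η := by
        refine add_le_add (h z hz) ?_
        rw [← mul_div_assoc, div_le_iff₀ hN]
        linarith

lemma dotp_add_left {n : ℕ} (x y z : Fin n → ℝ) : dotp (x + y) z = dotp x z + dotp y z := by
  simp [dotp, add_mul, Finset.sum_add_distrib]

lemma dotp_comm {n : ℕ} (x y : Fin n → ℝ) : dotp x y = dotp y x := by
  simp [dotp, mul_comm]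

lemma dotp_smul_left {n : ℕ} (t : ℝ) (x y : Fin n → ℝ) : dotp (t • x) y = t * dotp x y := by
  simp [dotp, Finset.mul_sum, mul_assoc]

lemma dotp_neg_left {n : ℕ} (x y : Fin n → ℝ) : dotp (-x) y = -dotp x y := by
  simp [dotp]

lemma dotp_zero_left {n : ℕ} (y : Fin n → ℝ) : dotp 0 y = 0 := by
  simp [dotp]

lemma dotp_sum_left {n : ℕ} {ι : Type*} (S : Finset ι) (x : ι → Fin n → ℝ) (y : Fin n → ℝ) :
    dotp (∑ i ∈ S, x i) y = ∑ i ∈ S, dotp (x i) y := by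
  simp only [dotp, Finset.sum_apply, Finset.sum_mul]
  exact Finset.sum_comm

/-- The affine function `z ↦ ⟨a, z⟩ + b`. -/
def dotpAffine {n : ℕ} (a : Fin n → ℝ) (b : ℝ) : (Fin n → ℝ) →ᵃ[ℝ] ℝ :=
  (∑ r, a r • (LinearMap.proj r : (Fin n → ℝ) →ₗ[ℝ] ℝ)).toAffineMap +
    AffineMap.const ℝ (Fin n → ℝ) b

lemma dotpAffine_apply {n : ℕ} (a : Fin n → ℝ) (b : ℝ) (z : Fin n → ℝ) :
    dotpAffine a b z = dotp a z + b := by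
  simp [dotpAffine, dotp]

/-- Fenchel duality for a finite sum of convex functions whose domains have a common point in
their relative interiors. -/
lemma exists_fenchel_split {κ : Type*} [Fintype κ] {n : ℕ} {D : Option κ → Set (Fin n → ℝ)}
    {h : Option κ → (Fin n → ℝ) → ℝ} (hh : ∀ i, ConvexOn ℝ (D i) (h i)) {x : Fin n → ℝ}
    (hx : ∀ i, IsRelCore (D i) x) (hn : ∀ z, (∀ i, z ∈ D i) → 0 ≤ ∑ i, h i z) :
    ∃ (ζ : Option κ → Fin n → ℝ) (b : Option κ → ℝ), ∑ i, ζ i = 0 ∧ ∑ i, b i ≤ 0 ∧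
      ∀ i, ∀ z ∈ D i, dotp (ζ i) z - h i z ≤ b i := by
  classical
  let e : κ × Fin n → (Option κ → Fin n → ℝ) →ᵃ[ℝ] ℝ := fun q =>
    ((LinearMap.proj q.2 : (Fin n → ℝ) →ₗ[ℝ] ℝ) ∘ₗ
      ((LinearMap.proj (some q.1) : (Option κ → Fin n → ℝ) →ₗ[ℝ] (Fin n → ℝ)) -
        LinearMap.proj none)).toAffineMap
  have he : ∀ q z, e q z = z (some q.1) q.2 - z none q.2 := fun q z => by simp [e]
  have hpi : Convex ℝ (Set.univ.pi D) := convex_pi fun i _ => (hh i).1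
  obtain ⟨σ, hσ⟩ := ConvexOn.exists_signed_multipliers (b := e) (Finset.univ)
    (x := fun _ => x) (fun q _ => by simp [he])
    (IsRelCore.pi hx fun i => (hh i).1)
    (H := fun z => ∑ i, h i (z i))
    (convexOn_finset_sum hpi _ fun i _ =>
      ((hh i).comp_linearMap
        (LinearMap.proj i : (Option κ → Fin n → ℝ) →ₗ[ℝ] (Fin n → ℝ))).subset
          (fun z (hz : z ∈ Set.univ.pi D) => hz i (mem_univ i)) hpi)
    (fun z hz hz0 => by
      have hconst : ∀ i, z i = z none := by
        rintro (_ | k)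
        · rfl
        · ext r
          have := hz0 (k, r) (Finset.mem_univ _)
          rw [he] at this
          linarith
      have h1 := hn (z none) fun i => hconst i ▸ hz i (mem_univ i)
      simpa only [hconst] using h1)
  let ζ : Option κ → Fin n → ℝ := fun i =>
    i.elim (∑ k, fun r => σ (k, r)) (fun k r => -σ (k, r))
  have hkey : ∀ z : Option κ → Fin n → ℝ, (∀ i, z i ∈ D i) →
      ∑ i, (dotp (ζ i) (z i) - h i (z i)) ≤ 0 := by
    intro z hz
    have h1 := hσ z fun i _ => hz i
    have h2 : ∑ q, σ q * e q z = -∑ i, dotp (ζ i) (z i) := by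
      rw [Fintype.sum_option, Fintype.sum_prod_type]
      simp only [ζ, Option.elim, dotp_sum_left, he]
      rw [← Finset.sum_add_distrib, ← Finset.sum_neg_distrib]
      refine Finset.sum_congr rfl fun k _ => ?_
      simp only [dotp]
      rw [← Finset.sum_add_distrib, ← Finset.sum_neg_distrib]
      exact Finset.sum_congr rfl fun r _ => by ring
    rw [Finset.sum_sub_distrib]
    linarith
  obtain ⟨b, hb, hb'⟩ := exists_sum_le_of_forall_sum_le (S := D)
    (φ := fun i z => dotp (ζ i) z - h i z) (fun i => ⟨x, (hx i).1⟩) hkey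
  refine ⟨ζ, b, ?_, hb, hb'⟩
  rw [Fintype.sum_option]
  simp only [ζ, Option.elim, ← Finset.sum_add_distrib]
  refine Finset.sum_eq_zero fun k _ => ?_
  ext r
  simp

lemma ConvexOn.exists_affine_minorant {n : ℕ} {D : Set (Fin n → ℝ)} {f : (Fin n → ℝ) → ℝ}
    {x : Fin n → ℝ} (hf : ConvexOn ℝ D f) (hx : IsRelCore D x) :
    ∃ (y : Fin n → ℝ) (β : ℝ), ∀ z ∈ D, dotp y z - β ≤ f z := by
  obtain ⟨σ, hσ⟩ := ConvexOn.exists_signed_multipliers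
    (b := fun r => dotpAffine (Pi.single r 1) (-x r)) Finset.univ
    (fun r _ => by simp [dotpAffine_apply, dotp, Pi.single_apply]) hx
    (hf.add (convexOn_const (-f x) hf.1)) (fun z hz h0 => by
      have : z = x := by
        ext r
        have := h0 r (Finset.mem_univ _)
        simp only [dotpAffine_apply, dotp, Pi.single_apply, ite_mul, one_mul, zero_mul,
          Finset.sum_ite_eq', Finset.mem_univ, if_true] at this
        linarith
      simp [this])
  refine ⟨-σ, -(f x + dotp σ x), fun z hz => ?_⟩
  have h1 := hσ z hz
  have h2 : ∑ r, σ r * dotpAffine (Pi.single r 1) (-x r) z = dotp σ z - dotp σ x := by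
    simp only [dotpAffine_apply, dotp, Pi.single_apply, ite_mul, one_mul, zero_mul,
          Finset.sum_ite_eq', Finset.mem_univ, if_true]
    rw [← Finset.sum_sub_distrib]
    exact Finset.sum_congr rfl fun r _ => by ring
  rw [h2] at h1
  simp only [Pi.add_apply] at h1
  rw [dotp_neg_left]
  linarith

section Conjugates

variable {n : ℕ} {f : (Fin n → ℝ) → EReal}

lemma ConvexE.convexOn_toReal (hf : ConvexE f) (hbot : ∀ x, f x ≠ ⊥) :
    ConvexOn ℝ {z | f z ≠ ⊤} (fun z => (f z).toReal) := by
  have key : ∀ x y : Fin n → ℝ, f x ≠ ⊤ → f y ≠ ⊤ → ∀ a b : ℝ, 0 ≤ a → 0 ≤ b → a + b = 1 →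
      f (a • x + b • y) ≤ ((a * (f x).toReal + b * (f y).toReal : ℝ) : EReal) := by
    intro x y hx hy a b ha hb hab
    have h := hf x y a b ha hb hab
    rw [← EReal.coe_toReal hx (hbot x), ← EReal.coe_toReal hy (hbot y)] at h
    exact_mod_cast h
  refine ⟨fun x hx y hy a b ha hb hab => ?_, fun x hx y hy a b ha hb hab => ?_⟩
  · exact ((key x y hx hy a b ha hb hab).trans_lt (EReal.coe_lt_top _)).ne
  · have h := key x y hx hy a b ha hb hab
    have h2 := EReal.toReal_le_toReal h (hbot _) (EReal.coe_ne_top _)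
    rwa [EReal.toReal_coe] at h2

lemma le_conjE (f : (Fin n → ℝ) → EReal) (y x : Fin n → ℝ) :
    ((dotp y x : ℝ) : EReal) - f x ≤ conjE f y :=
  le_iSup (fun x => ((dotp y x : ℝ) : EReal) - f x) x

lemma conjE_le_coe {y : Fin n → ℝ} {B : ℝ} (hbot : ∀ x, f x ≠ ⊥)
    (h : ∀ z, f z ≠ ⊤ → dotp y z - (f z).toReal ≤ B) : conjE f y ≤ B := by
  refine iSup_le fun z => ?_
  by_cases hz : f z = ⊤
  · simp [hz]
  · rw [← EReal.coe_toReal hz (hbot z), ← EReal.coe_sub]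
    exact EReal.coe_le_coe_iff.2 (h z hz)

lemma conjE_conjE_le {z : Fin n → ℝ} (hz : f z ≠ ⊤) (hbot : f z ≠ ⊥) :
    conjE (conjE f) z ≤ f z := by
  refine iSup_le fun y => ?_
  have h := le_conjE f y z
  rw [← EReal.coe_toReal hz hbot] at h ⊢
  rw [dotp_comm] at h
  rcases eq_or_ne (conjE f y) ⊤ with hc | hc
  · simp [hc]
  have hc' : conjE f y ≠ ⊥ := fun hb => by
    rw [hb, ← EReal.coe_sub] at h
    exact absurd (le_bot_iff.1 h) (EReal.coe_ne_bot _)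
  rw [← EReal.coe_toReal hc hc'] at h ⊢
  norm_cast at h ⊢
  linarith

lemma le_perspE_conjE {z ζ : Fin n → ℝ} {t : ℝ} (ht : 0 ≤ t) (hz : f z ≠ ⊤) (hbot : f z ≠ ⊥) :
    ((dotp ζ z - t * (f z).toReal : ℝ) : EReal) ≤ perspE (conjE f) ζ t := by
  unfold perspE
  split_ifs with h
  · have h1 := le_conjE f (t⁻¹ • ζ) z
    rw [← EReal.coe_toReal hz hbot, ← EReal.coe_sub, dotp_smul_left] at h1
    have h2 : (t : EReal) * ((t⁻¹ * dotp ζ z - (f z).toReal : ℝ) : EReal) ≤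
        t * conjE f (t⁻¹ • ζ) := mul_le_mul_of_nonneg_left h1 (EReal.coe_nonneg.2 ht)
    refine le_trans (le_of_eq ?_) h2
    rw [← EReal.coe_mul]
    congr 1
    field_simp
  · have ht0 : t = 0 := le_antisymm (not_lt.1 h) ht
    have hz' : z ∈ {u | conjE (conjE f) u ≠ ⊤} :=
      ((conjE_conjE_le hz hbot).trans_lt (lt_top_iff_ne_top.2 hz)).ne
    refine le_trans (le_of_eq ?_)
      (le_iSup₂ (f := fun (u : Fin n → ℝ) (_ : u ∈ {u | conjE (conjE f) u ≠ ⊤}) =>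
        ((dotp ζ u : ℝ) : EReal)) z hz')
    simp [ht0]

lemma perspE_conjE_le {ζ y : Fin n → ℝ} {t B β : ℝ} (ht : 0 ≤ t) (hbot : ∀ x, f x ≠ ⊥)
    (hmin : ∀ z, f z ≠ ⊤ → dotp y z - β ≤ (f z).toReal)
    (h : ∀ z, f z ≠ ⊤ → dotp ζ z - t * (f z).toReal ≤ B) : perspE (conjE f) ζ t ≤ B := by
  unfold perspE
  split_ifs with ht'
  · have h1 : conjE f (t⁻¹ • ζ) ≤ ((t⁻¹ * B : ℝ) : EReal) := by
      refine conjE_le_coe hbot fun z hz => ?_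
      have := mul_le_mul_of_nonneg_left (h z hz) (inv_nonneg.2 ht)
      rw [mul_sub, inv_mul_cancel_left₀ ht'.ne'] at this
      rwa [dotp_smul_left]
    refine (mul_le_mul_of_nonneg_left h1 (EReal.coe_nonneg.2 ht)).trans (le_of_eq ?_)
    rw [← EReal.coe_mul]
    congr 1
    field_simp
  · have ht0 : t = 0 := le_antisymm (not_lt.1 ht') ht
    subst ht0
    refine iSup₂_le fun u hu => EReal.coe_le_coe_iff.2 ?_
    by_contra! hlt
    refine hu (EReal.eq_top_iff_forall_lt _ |>.2 fun M => ?_)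
    have hline : ∀ r : ℝ, 0 ≤ r → conjE f (y + r • ζ) ≤ ((β + r * B : ℝ) : EReal) := by
      intro r hr
      refine conjE_le_coe hbot fun z hz => ?_
      have h1 := mul_le_mul_of_nonneg_left (h z hz) hr
      rw [dotp_add_left, dotp_smul_left]
      linarith [hmin z hz]
    have hgrow : ∀ r : ℝ, 0 ≤ r →
        ((dotp y u - β + r * (dotp ζ u - B) : ℝ) : EReal) ≤ conjE (conjE f) u := by
      intro r hr
      refine le_trans ?_ (le_conjE (conjE f) u (y + r • ζ))
      refine le_trans (le_of_eq ?_) (EReal.sub_le_sub le_rfl (hline r hr))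
      rw [← EReal.coe_sub, dotp_comm u (y + r • ζ), dotp_add_left, dotp_smul_left]
      congr 1
      ring
    let r : ℝ := (|M| + |dotp y u - β| + 1) / (dotp ζ u - B)
    have hd : 0 < dotp ζ u - B := sub_pos.2 hlt
    have hr : 0 ≤ r := by positivity
    refine lt_of_lt_of_le (EReal.coe_lt_coe_iff.2 ?_) (hgrow r hr)
    rw [div_mul_cancel₀ _ hd.ne']
    linarith [le_abs_self M, neg_abs_le (dotp y u - β)]

end Conjugates

lemma EReal.sum_le_coe_sum {ι : Type*} (S : Finset ι) {a : ι → EReal} {b : ι → ℝ}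
    (h : ∀ i ∈ S, a i ≤ b i) : ∑ i ∈ S, a i ≤ ((∑ i ∈ S, b i : ℝ) : EReal) := by
  classical
  induction S using Finset.induction_on with
  | empty => simp
  | insert i S hi ih =>
    rw [Finset.sum_insert hi, Finset.sum_insert hi, EReal.coe_add]
    exact add_le_add (h i (Finset.mem_insert_self _ _))
      (ih fun k hk => h k (Finset.mem_insert_of_mem hk))

lemma EReal.coe_sum_le_sum {ι : Type*} (S : Finset ι) {a : ι → EReal} {b : ι → ℝ}
    (h : ∀ i ∈ S, (b i : EReal) ≤ a i) : ((∑ i ∈ S, b i : ℝ) : EReal) ≤ ∑ i ∈ S, a i := by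
  classical
  induction S using Finset.induction_on with
  | empty => simp
  | insert i S hi ih =>
    rw [Finset.sum_insert hi, Finset.sum_insert hi, EReal.coe_add]
    exact add_le_add (h i (Finset.mem_insert_self _ _))
      (ih fun k hk => h k (Finset.mem_insert_of_mem hk))

/-- Lagrange multipliers for convex constraints that hold strictly at `x` unless affine. -/
lemma ConvexOn.exists_multipliers {κ : Type*} [Fintype κ] {n : ℕ} {D : Set (Fin n → ℝ)}
    {H : (Fin n → ℝ) → ℝ} {g : κ → (Fin n → ℝ) → ℝ} {x : Fin n → ℝ} (hH : ConvexOn ℝ D H)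
    (hg : ∀ k, ConvexOn ℝ D (g k)) (hx : IsRelCore D x) (hgx : ∀ k, g k x ≤ 0)
    (hslater : ∀ k, ¬ (∃ a : (Fin n → ℝ) →ᵃ[ℝ] ℝ, g k = a) → g k x < 0)
    (hn : ∀ z ∈ D, (∀ k, g k z ≤ 0) → 0 ≤ H z) :
    ∃ τ : κ → ℝ, (∀ k, 0 ≤ τ k) ∧ ∀ z ∈ D, 0 ≤ H z + ∑ k, τ k * g k z := by
  classical
  let A : κ → Prop := fun k => ∃ a : (Fin n → ℝ) →ᵃ[ℝ] ℝ, g k = a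
  let D₁ : Set (Fin n → ℝ) := {z ∈ D | ∀ k, A k → g k z ≤ 0}
  have hD₁ : Convex ℝ D₁ := by
    intro u hu w hw s t hs ht hst
    refine ⟨hH.1 hu.1 hw.1 hs ht hst, fun k hk => ?_⟩
    refine ((hg k).2 hu.1 hw.1 hs ht hst).trans ?_
    have h1 := mul_nonneg hs (neg_nonneg.2 (hu.2 k hk))
    have h2 := mul_nonneg ht (neg_nonneg.2 (hw.2 k hk))
    simp only [smul_eq_mul]
    linarith
  obtain ⟨τ₁, hτ₁, h1⟩ := ConvexOn.exists_multipliers_of_slater (g := g) (x := x)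
    (Finset.univ.filter fun k => ¬ A k) (D := D₁) ⟨hx.1, fun k _ => hgx k⟩
    (hH.subset (sep_subset _ _) hD₁) (fun k _ => (hg k).subset (sep_subset _ _) hD₁)
    (fun k hk => hslater k (Finset.mem_filter.1 hk).2)
    (fun z hz hzk => hn z hz.1 fun k => by
      by_cases hk : A k
      · exact hz.2 k hk
      · exact hzk k (Finset.mem_filter.2 ⟨Finset.mem_univ _, hk⟩))
  have hchoose : ∀ k, ∃ a : (Fin n → ℝ) →ᵃ[ℝ] ℝ, A k → g k = a := by
    intro k
    by_cases hk : A k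
    · obtain ⟨a, ha⟩ := hk
      exact ⟨a, fun _ => ha⟩
    · exact ⟨0, fun h => absurd h hk⟩
  choose a ha using hchoose
  obtain ⟨τ₂, hτ₂, h2⟩ := ConvexOn.exists_multipliers_of_affine (a := a) (x := x)
    (Finset.univ.filter A)
    (fun k hk => by
      rw [← ha k (Finset.mem_filter.1 hk).2]
      exact hgx k)
    (H := fun z => H z + ∑ k ∈ Finset.univ.filter (fun k => ¬ A k), τ₁ k * g k z) hx
    (hH.add (convexOn_finset_sum hH.1 _ fun k _ => (hg k).smul (hτ₁ k)))
    (fun z hz hzk => h1 z ⟨hz, fun k hk => by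
      rw [ha k hk]
      exact hzk k (Finset.mem_filter.2 ⟨Finset.mem_univ _, hk⟩)⟩)
  refine ⟨fun k => if A k then τ₂ k else τ₁ k, fun k => ?_, fun z hz => ?_⟩
  · dsimp only
    split_ifs
    exacts [hτ₂ k, hτ₁ k]
  · have h3 : ∑ k, (if A k then τ₂ k else τ₁ k) * g k z =
        ∑ k ∈ Finset.univ.filter A, τ₂ k * a k z +
        ∑ k ∈ Finset.univ.filter (fun k => ¬ A k), τ₁ k * g k z := by
      rw [← Finset.sum_filter_add_sum_filter_not Finset.univ A]
      congr 1
      · refine Finset.sum_congr rfl fun k hk => ?_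
        have hk := (Finset.mem_filter.1 hk).2
        rw [if_pos hk, ← ha k hk]
      · refine Finset.sum_congr rfl fun k hk => ?_
        rw [if_neg (Finset.mem_filter.1 hk).2]
    rw [h3]
    linarith [h2 z hz]

/-- Strong duality, with attainment, for maximizing `L - lam * C` under convex constraints. -/
lemma exists_conjugate_certificate {n K : ℕ} {fk : Fin K → (Fin n → ℝ) → EReal}
    (hfk : ∀ k, ProperE (fk k) ∧ ConvexE (fk k)) {C : (Fin n → ℝ) → EReal} (hC : ProperE C)
    (hCconv : ConvexE C) {L : (Fin n → ℝ) → ℝ} (hL : ConcaveOn ℝ Set.univ L) {x : Fin n → ℝ}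
    (hxC : IsRelCore {z | C z ≠ ⊤} x) (hxf : ∀ k, IsRelCore {z | fk k z ≠ ⊤} x)
    (hx : ∀ k, fk k x ≤ 0)
    (hslater : ∀ k, ¬ (∃ (a : Fin n → ℝ) (b : ℝ), ∀ z, fk k z = ((dotp a z + b : ℝ) : EReal)) →
      fk k x < 0) {lam s : ℝ} (hlam : 0 ≤ lam)
    (hle : ∀ z, C z ≠ ⊤ → (∀ k, fk k z ≤ 0) → L z - lam * (C z).toReal ≤ s) :
    ∃ (τ : Fin K → ℝ) (ζl ζc : Fin n → ℝ) (ζf : Fin K → Fin n → ℝ), (∀ k, 0 ≤ τ k) ∧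
      ζl + ζc + ∑ k, ζf k = 0 ∧
      (⨆ z : Fin n → ℝ, ((dotp ζl z + L z : ℝ) : EReal)) + perspE (conjE C) ζc lam +
        ∑ k, perspE (conjE (fk k)) (ζf k) (τ k) ≤ (s : EReal) := by
  have hCr := hCconv.convexOn_toReal hC.1
  have hfr := fun k => (hfk k).2.convexOn_toReal (hfk k).1.1
  let D : Set (Fin n → ℝ) := {z | C z ≠ ⊤} ∩ ⋂ k, {z | fk k z ≠ ⊤}
  have hDf : ∀ k, D ⊆ {z | fk k z ≠ ⊤} := fun k z hz => mem_iInter.1 hz.2 k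
  have hconvf : Convex ℝ (⋂ k, {z | fk k z ≠ ⊤}) := convex_iInter fun k => (hfr k).1
  have hD : Convex ℝ D := hCr.1.inter hconvf
  have hxD : IsRelCore D x :=
    hxC.inter (IsRelCore.iInter hxf fun k => (hfr k).1) hCr.1 hconvf
  have hnegL : ConvexOn ℝ Set.univ (fun z => -L z + s) := hL.neg.add (convexOn_const s convex_univ)
  have hlamC : ConvexOn ℝ {z | C z ≠ ⊤} (fun z => lam * (C z).toReal) := hCr.smul hlam
  have htoReal : ∀ k, fk k x < 0 → (fk k x).toReal < 0 := by
    intro k hk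
    rw [← EReal.coe_toReal ((hxf k).1) ((hfk k).1.1 x)] at hk
    exact_mod_cast hk
  have htoReal' : ∀ k z, fk k z ≤ 0 → (fk k z).toReal ≤ 0 := fun k z hk => by
    simpa using EReal.toReal_le_toReal hk ((hfk k).1.1 z) EReal.zero_ne_top
  obtain ⟨τ, hτ, h1⟩ := ConvexOn.exists_multipliers (D := D) (x := x)
    (H := fun z => (-L z + s) + lam * (C z).toReal) (g := fun k z => (fk k z).toReal)
    ((hnegL.subset (subset_univ _) hD).add (hlamC.subset inter_subset_left hD))
    (fun k => (hfr k).subset (hDf k) hD) hxD (fun k => htoReal' k x (hx k))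
    (fun k hk => htoReal k (hslater k (by
      rintro ⟨a, b, hab⟩
      refine hk ⟨dotpAffine a b, ?_⟩
      ext z
      rw [hab z, dotpAffine_apply, EReal.toReal_coe])))
    (fun z hz hzk => by
      have := hle z hz.1 fun k => by
        rw [← EReal.coe_toReal (hDf k hz) ((hfk k).1.1 z)]
        exact_mod_cast hzk k
      linarith)
  obtain ⟨ζ, b, hζ, hb, h2⟩ := exists_fenchel_split (κ := Option (Fin K)) (x := x)
    (D := fun i => i.elim Set.univ fun i => i.elim {z | C z ≠ ⊤} fun k => {z | fk k z ≠ ⊤})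
    (h := fun i => i.elim (fun z => -L z + s) fun i => i.elim (fun z => lam * (C z).toReal)
      fun k z => τ k * (fk k z).toReal)
    (by
      rintro (_ | _ | k)
      exacts [hnegL, hlamC, (hfr k).smul (hτ k)])
    (by
      rintro (_ | _ | k)
      exacts [IsRelCore.univ x, hxC, hxf k])
    (fun z hz => by
      have h3 := h1 z ⟨hz (some none), mem_iInter.2 fun k => hz (some (some k))⟩
      simp only [Fintype.sum_option, Option.elim]
      linarith)
  simp only [Fintype.sum_option] at hζ hb
  refine ⟨τ, ζ none, ζ (some none), fun k => ζ (some (some k)), hτ, by rw [add_assoc]; exact hζ, ?_⟩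
  have hl : (⨆ z : Fin n → ℝ, ((dotp (ζ none) z + L z : ℝ) : EReal)) ≤
      ((b none + s : ℝ) : EReal) := by
    refine iSup_le fun z => EReal.coe_le_coe_iff.2 ?_
    have := h2 none z (mem_univ z)
    simp only [Option.elim] at this
    linarith
  have hc : perspE (conjE C) (ζ (some none)) lam ≤ (b (some none) : EReal) := by
    obtain ⟨y, β, hy⟩ := hCr.exists_affine_minorant hxC
    exact perspE_conjE_le hlam hC.1 hy (h2 (some none))
  have hf : ∀ k, perspE (conjE (fk k)) (ζ (some (some k))) (τ k) ≤ (b (some (some k)) : EReal) := by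
    intro k
    obtain ⟨y, β, hy⟩ := (hfr k).exists_affine_minorant (hxf k)
    exact perspE_conjE_le (hτ k) (hfk k).1.1 hy (h2 (some (some k)))
  refine (add_le_add (add_le_add hl hc) (EReal.sum_le_coe_sum _ fun k _ => hf k)).trans ?_
  norm_cast
  linarith

/-- Weak duality: a certificate bounds `L` by `s + lam * C` on the constraint set. -/
lemma le_of_conjugate_certificate {n K : ℕ} {fk : Fin K → (Fin n → ℝ) → EReal}
    (hfk : ∀ k, ProperE (fk k)) {C : (Fin n → ℝ) → EReal} {L : (Fin n → ℝ) → ℝ} {lam s : ℝ}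
    (hlam : 0 ≤ lam) {τ : Fin K → ℝ} {ζl ζc : Fin n → ℝ} {ζf : Fin K → Fin n → ℝ}
    (hτ : ∀ k, 0 ≤ τ k) (hζ : ζl + ζc + ∑ k, ζf k = 0)
    (hs : (⨆ z : Fin n → ℝ, ((dotp ζl z + L z : ℝ) : EReal)) + perspE (conjE C) ζc lam +
        ∑ k, perspE (conjE (fk k)) (ζf k) (τ k) ≤ (s : EReal))
    {z : Fin n → ℝ} (hz : ∀ k, fk k z ≤ 0) (hCtop : C z ≠ ⊤) (hCbot : C z ≠ ⊥) :
    L z ≤ s + lam * (C z).toReal := by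
  have hl : ((dotp ζl z + L z : ℝ) : EReal) ≤ ⨆ z : Fin n → ℝ, ((dotp ζl z + L z : ℝ) : EReal) :=
    le_iSup (fun z => ((dotp ζl z + L z : ℝ) : EReal)) z
  have hc := le_perspE_conjE (ζ := ζc) hlam hCtop hCbot
  have hf : ∀ k, ((dotp (ζf k) z : ℝ) : EReal) ≤ perspE (conjE (fk k)) (ζf k) (τ k) := by
    intro k
    have htop : fk k z ≠ ⊤ := ((hz k).trans_lt EReal.zero_lt_top).ne
    refine le_trans (EReal.coe_le_coe_iff.2 ?_) (le_perspE_conjE (hτ k) htop ((hfk k).1 z))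
    have h1 : (fk k z).toReal ≤ 0 := by
      simpa using EReal.toReal_le_toReal (hz k) ((hfk k).1 z) EReal.zero_ne_top
    linarith [mul_nonneg (hτ k) (neg_nonneg.2 h1)]
  have h1 := (add_le_add (add_le_add hl hc) (EReal.coe_sum_le_sum _ fun k _ => hf k)).trans hs
  norm_cast at h1
  have h2 : dotp (ζl + ζc + ∑ k, ζf k) z = 0 := by rw [hζ, dotp_zero_left]
  rw [dotp_add_left, dotp_add_left, dotp_sum_left] at h2
  linarith

section Discrete

variable {α ι : Type*} [MeasurableSpace α] [Fintype ι]

lemma lintegral_sum_dirac {w : ι → ℝ} {x : ι → α} {f : α → ℝ≥0∞} (hf : Measurable f) :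
    ∫⁻ a, f a ∂(∑ i, ENNReal.ofReal (w i) • Measure.dirac (x i)) =
      ∑ i, ENNReal.ofReal (w i) * f (x i) := by
  rw [lintegral_finsetSum_measure]
  refine Finset.sum_congr rfl fun i _ => ?_
  rw [lintegral_smul_measure, lintegral_dirac' _ hf, smul_eq_mul]

lemma erealPos_coe (r : ℝ) : erealPos (r : EReal) = ENNReal.ofReal r := by
  simp [erealPos]

lemma eint_coe (μ : Measure α) (f : α → ℝ) :
    eint μ (fun a => (f a : EReal)) = ((∫⁻ a, ENNReal.ofReal (f a) ∂μ : ℝ≥0∞) : EReal) -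
      ((∫⁻ a, ENNReal.ofReal (-f a) ∂μ : ℝ≥0∞) : EReal) := by
  simp only [eint, ← EReal.coe_neg, erealPos_coe]

lemma lintegral_ofReal_sum_dirac {w : ι → ℝ} (hw : ∀ i, 0 ≤ w i) {x : ι → α} {f : α → ℝ}
    (hf : Measurable f) :
    ∫⁻ a, ENNReal.ofReal (f a) ∂(∑ i, ENNReal.ofReal (w i) • Measure.dirac (x i)) =
      ENNReal.ofReal (∑ i, w i * max (f (x i)) 0) := by
  rw [lintegral_sum_dirac hf.ennreal_ofReal,
    ENNReal.ofReal_sum_of_nonneg fun i _ => mul_nonneg (hw i) (le_max_right _ _)]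
  refine Finset.sum_congr rfl fun i _ => ?_
  rw [ENNReal.ofReal_mul (hw i)]
  congr 1
  simp [ENNReal.ofReal, Real.toNNReal]

lemma eint_sum_dirac {w : ι → ℝ} (hw : ∀ i, 0 ≤ w i) {x : ι → α} {f : α → ℝ}
    (hf : Measurable f) :
    eint (∑ i, ENNReal.ofReal (w i) • Measure.dirac (x i)) (fun a => (f a : EReal)) =
      ((∑ i, w i * f (x i) : ℝ) : EReal) := by
  have h0 : ∀ g : α → ℝ, 0 ≤ ∑ i, w i * max (g (x i)) 0 := fun g =>
    Finset.sum_nonneg fun i _ => mul_nonneg (hw i) (le_max_right _ _)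
  rw [eint_coe, lintegral_ofReal_sum_dirac hw hf,
      lintegral_ofReal_sum_dirac (f := fun a => -f a) hw hf.neg,
    EReal.coe_ennreal_ofReal, EReal.coe_ennreal_ofReal, max_eq_left (h0 f),
    max_eq_left (h0 (fun a => -f a)), ← EReal.coe_sub, ← Finset.sum_sub_distrib]
  congr 1
  refine Finset.sum_congr rfl fun i _ => ?_
  rw [← mul_sub]
  congr 1
  rcases le_total 0 (f (x i)) with h | h
  · rw [max_eq_left h, max_eq_right (neg_nonpos.2 h), sub_zero]
  · rw [max_eq_right h, max_eq_left (neg_nonneg.2 h)]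
    ring

lemma map_sum_dirac {β : Type*} [MeasurableSpace β] {g : α → β} (hg : Measurable g) (w : ι → ℝ)
    (x : ι → α) :
    (∑ i, ENNReal.ofReal (w i) • Measure.dirac (x i)).map g =
      ∑ i, ENNReal.ofReal (w i) • Measure.dirac (g (x i)) := by
  rw [Measure.map_finset_sum hg.aemeasurable]
  exact Finset.sum_congr rfl fun i _ => by rw [Measure.map_smul, Measure.map_dirac' hg]

lemma OTDiscrepancy_sum_dirac_le {c : α → α → ℝ≥0∞}
    (hc : Measurable fun p : α × α => c p.1 p.2) (w : ι → ℝ) (x y : ι → α) :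
    OTDiscrepancy c (∑ i, ENNReal.ofReal (w i) • Measure.dirac (x i))
      (∑ i, ENNReal.ofReal (w i) • Measure.dirac (y i)) ≤
      ∑ i, ENNReal.ofReal (w i) * c (x i) (y i) := by
  refine iInf₂_le_of_le (∑ i, ENNReal.ofReal (w i) • Measure.dirac (x i, y i))
    ⟨map_sum_dirac measurable_fst _ _, map_sum_dirac measurable_snd _ _⟩ ?_
  rw [lintegral_sum_dirac hc]

lemma isProbabilityMeasure_sum_dirac {w : ι → ℝ} (hw : ∀ i, 0 ≤ w i) (hsum : ∑ i, w i = 1)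
    (x : ι → α) : IsProbabilityMeasure (∑ i, ENNReal.ofReal (w i) • Measure.dirac (x i)) := by
  constructor
  rw [← lintegral_one, lintegral_sum_dirac measurable_const]
  simp only [mul_one]
  rw [← ENNReal.ofReal_sum_of_nonneg fun i _ => hw i, hsum, ENNReal.ofReal_one]

lemma eint_le_of_coupling {Q P : Measure α} {π : Measure (α × α)} (hπ : π ∈ couplings Q P)
    {c : α → α → ℝ≥0∞} (hc : Measurable fun p : α × α => c p.1 p.2) {p : ι → ℝ}
    (hp : ∀ i, 0 ≤ p i) {x : ι → α} (hP : P = ∑ i, ENNReal.ofReal (p i) • Measure.dirac (x i))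
    (hx : MeasurableSet (range x))
    {f S : α → ℝ} (hf : Measurable f) (hS : Measurable S) {lam e : ℝ} (hlam : 0 ≤ lam)
    (he : 0 ≤ e) (hcost : ∫⁻ p, c p.1 p.2 ∂π ≤ ENNReal.ofReal e)
    (hle : ∀ z i, c z (x i) ≠ ⊤ → f z ≤ S (x i) + lam * (c z (x i)).toReal) :
    eint Q (fun z => (f z : EReal)) ≤ ((lam * e + ∑ i, p i * S (x i) : ℝ) : EReal) := by
  obtain ⟨hπ₁, hπ₂⟩ := hπ
  have hsupp : ∀ᵐ q ∂π, q.2 ∈ range x := by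
    refine ae_of_ae_map (p := fun a => a ∈ range x) measurable_snd.aemeasurable ?_
    rw [hπ₂, ae_iff, hP]
    have : MeasurableSet {a | a ∉ range x} := hx.compl
    simp only [Measure.coe_finsetSum, Measure.coe_smul, Finset.sum_apply, Pi.smul_apply]
    refine Finset.sum_eq_zero fun i _ => ?_
    rw [Measure.dirac_apply' _ this]
    simp
  have hfin : ∀ᵐ q ∂π, c q.1 q.2 < ⊤ :=
    ae_lt_top hc (hcost.trans_lt ENNReal.ofReal_lt_top).ne
  have hpt : ∀ᵐ q ∂π, ENNReal.ofReal (f q.1) + ENNReal.ofReal (-S q.2) ≤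
      (ENNReal.ofReal (-f q.1) + ENNReal.ofReal lam * c q.1 q.2) + ENNReal.ofReal (S q.2) := by
    filter_upwards [hsupp, hfin] with q hq hq'
    obtain ⟨i, hi⟩ := hq
    have h1 := hle q.1 i (hi ▸ hq'.ne)
    rw [hi] at h1
    have h2 : c q.1 q.2 = ENNReal.ofReal (c q.1 q.2).toReal := (ENNReal.ofReal_toReal hq'.ne).symm
    rw [h2, ← ENNReal.ofReal_mul hlam]
    have h0 : 0 ≤ lam * (c q.1 q.2).toReal := mul_nonneg hlam ENNReal.toReal_nonneg
    have hm : ∀ r : ℝ, ENNReal.ofReal r = ENNReal.ofReal (max r 0) := fun r => by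
      simp [ENNReal.ofReal, Real.toNNReal]
    rw [hm (f q.1), hm (-S q.2), hm (-f q.1), hm (S q.2),
      ← ENNReal.ofReal_add (le_max_right _ _) (le_max_right _ _),
      ← ENNReal.ofReal_add (le_max_right _ _) h0,
      ← ENNReal.ofReal_add (add_nonneg (le_max_right _ _) h0) (le_max_right _ _)]
    refine ENNReal.ofReal_le_ofReal ?_
    rcases le_total 0 (f q.1) with ha | ha <;> rcases le_total 0 (S q.2) with hb | hb <;>
    simp only [max_eq_left, max_eq_right, ha, hb, neg_nonpos.2, neg_nonneg.2] <;> linarith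
  have h_lint := lintegral_mono_ae hpt
  have hf₁ : Measurable fun q : α × α => ENNReal.ofReal (f q.1) :=
    (hf.comp measurable_fst).ennreal_ofReal
  have hf₂ : Measurable fun q : α × α => ENNReal.ofReal (-f q.1) :=
    (hf.comp measurable_fst).neg.ennreal_ofReal
  have hQ : ∀ g : α → ℝ≥0∞, Measurable g → ∫⁻ q, g q.1 ∂π = ∫⁻ a, g a ∂Q := fun g hg => by
    rw [← hπ₁, lintegral_map hg measurable_fst]
  have hP' : ∀ g : α → ℝ≥0∞, Measurable g → ∫⁻ q, g q.2 ∂π = ∫⁻ a, g a ∂P := fun g hg => by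
    rw [← hπ₂, lintegral_map hg measurable_snd]
  have hf₃ : Measurable fun q : α × α =>
      ENNReal.ofReal (-f q.1) + ENNReal.ofReal lam * c q.1 q.2 := hf₂.add (hc.const_mul _)
  rw [lintegral_add_left hf₁, lintegral_add_left hf₃,
    lintegral_add_left hf₂, lintegral_const_mul _ hc,
    hQ (fun a => ENNReal.ofReal (f a)) hf.ennreal_ofReal,
    hQ (fun a => ENNReal.ofReal (-f a)) hf.neg.ennreal_ofReal,
    hP' (fun a => ENNReal.ofReal (S a)) hS.ennreal_ofReal,
    hP' (fun a => ENNReal.ofReal (-S a)) hS.neg.ennreal_ofReal] at h_lint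
  have hPS : eint P (fun a => (S a : EReal)) = ((∑ i, p i * S (x i) : ℝ) : EReal) := by
    rw [hP]; exact eint_sum_dirac hp hS
  have hSp : ∫⁻ a, ENNReal.ofReal (S a) ∂P ≠ ⊤ := by
    rw [hP, lintegral_ofReal_sum_dirac hp hS]; exact ENNReal.ofReal_ne_top
  have hSm : ∫⁻ a, ENNReal.ofReal (-S a) ∂P ≠ ⊤ := by
    rw [hP, lintegral_ofReal_sum_dirac (f := fun a => -S a) hp hS.neg]; exact ENNReal.ofReal_ne_top
  rw [eint_coe] at hPS ⊢
  have h_lint' := h_lint.trans (add_le_add (add_le_add le_rfl (mul_le_mul_right hcost _)) le_rfl)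
  rw [← ENNReal.ofReal_mul hlam] at h_lint'
  generalize ∫⁻ a, ENNReal.ofReal (f a) ∂Q = Fp at *
  generalize ∫⁻ a, ENNReal.ofReal (-f a) ∂Q = Fm at *
  generalize ∫⁻ a, ENNReal.ofReal (S a) ∂P = Sp at *
  generalize ∫⁻ a, ENNReal.ofReal (-S a) ∂P = Sm at *
  rcases eq_or_ne Fm ⊤ with hFm | hFm
  · simp [hFm]
  have hFp : Fp ≠ ⊤ := by
    refine ne_top_of_le_ne_top ?_ (le_self_add.trans h_lint')
    exact ENNReal.add_ne_top.2 ⟨ENNReal.add_ne_top.2 ⟨hFm, ENNReal.ofReal_ne_top⟩, hSp⟩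
  lift Fp to NNReal using hFp
  lift Fm to NNReal using hFm
  lift Sp to NNReal using hSp
  lift Sm to NNReal using hSm
  have h1 : (Fp : ℝ) + Sm ≤ Fm + lam * e + Sp := by
    have h0 : 0 ≤ lam * e := mul_nonneg hlam he
    rw [← ENNReal.ofReal_coe_nnreal, ← ENNReal.ofReal_coe_nnreal, ← ENNReal.ofReal_coe_nnreal,
      ← ENNReal.ofReal_coe_nnreal, ← ENNReal.ofReal_add Fp.coe_nonneg Sm.coe_nonneg,
      ← ENNReal.ofReal_add Fm.coe_nonneg h0,
      ← ENNReal.ofReal_add (add_nonneg Fm.coe_nonneg h0) Sp.coe_nonneg] at h_lint'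
    exact (ENNReal.ofReal_le_ofReal_iff
      (add_nonneg (add_nonneg Fm.coe_nonneg h0) Sp.coe_nonneg)).1 h_lint'
  have h2 : (Sp : ℝ) - Sm = ∑ i, p i * S (x i) := by
    rw [EReal.coe_nnreal_eq_coe_real, EReal.coe_nnreal_eq_coe_real] at hPS
    exact_mod_cast hPS
  have h3 : (Fp : ℝ) - Fm ≤ lam * e + ∑ i, p i * S (x i) := by linarith
  rw [EReal.coe_nnreal_eq_coe_real, EReal.coe_nnreal_eq_coe_real]
  exact_mod_cast h3

/-- Existence of an optimal price for the transportation budget. -/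
lemma exists_transport_price {c : α → α → ℝ≥0∞} (hc : Measurable fun p : α × α => c p.1 p.2)
    (hc0 : ∀ z, c z z = 0) {p : ι → ℝ} (hp : ∀ i, 0 < p i) (hsum : ∑ i, p i = 1) {x : ι → α}
    {P : ProbabilityMeasure α}
    (hP : P.toMeasure = ∑ i, ENNReal.ofReal (p i) • Measure.dirac (x i)) {ε : ℝ} (hε : 0 < ε)
    {f : α → ℝ} (hf : Measurable f) {v : ℝ}
    (hv : ∀ Q ∈ ambiguitySet c P ε, eint Q.toMeasure (fun z => (f z : EReal)) ≤ v) :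
    ∃ (lam : ℝ) (s : ι → ℝ), 0 ≤ lam ∧ lam * ε + ∑ i, p i * s i ≤ v ∧
      ∀ i z, c z (x i) ≠ ⊤ → f z - lam * (c z (x i)).toReal ≤ s i := by
  let T : Set (ι → α) := {z | ∀ i, c (z i) (x i) ≠ ⊤}
  let G : (ι → α) → ℝ := fun z => ∑ i, p i * (c (z i) (x i)).toReal
  let F : (ι → α) → ℝ := fun z => ∑ i, p i * f (z i)
  have hmix : ∀ z ∈ T, ∀ z' ∈ T, ∀ a b : ℝ, 0 ≤ a → 0 ≤ b → a + b = 1 →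
      a * G z + b * G z' ≤ ε → a * F z + b * F z' ≤ v := by
    intro z hz z' hz' a b ha hb hab hcost
    let w : ι ⊕ ι → ℝ := Sum.elim (fun i => a * p i) (fun i => b * p i)
    let y : ι ⊕ ι → α := Sum.elim z z'
    have hw : ∀ i, 0 ≤ w i := by
      rintro (i | i)
      exacts [mul_nonneg ha (hp i).le, mul_nonneg hb (hp i).le]
    have hw1 : ∑ i, w i = 1 := by
      simp only [w, Fintype.sum_sum_type, Sum.elim_inl, Sum.elim_inr, ← Finset.mul_sum, hsum]
      linarith
    have hPw : P.toMeasure = ∑ i, ENNReal.ofReal (w i) • Measure.dirac (Sum.elim x x i) := by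
      rw [hP, Fintype.sum_sum_type, ← Finset.sum_add_distrib]
      refine Finset.sum_congr rfl fun i _ => ?_
      simp only [w, Sum.elim_inl, Sum.elim_inr]
      rw [← add_smul, ← ENNReal.ofReal_add (mul_nonneg ha (hp i).le) (mul_nonneg hb (hp i).le),
        ← add_mul, hab, one_mul]
    let Q : ProbabilityMeasure α := ⟨_, isProbabilityMeasure_sum_dirac hw hw1 y⟩
    have hQ : Q ∈ ambiguitySet c P ε := by
      change OTDiscrepancy c (∑ i, ENNReal.ofReal (w i) • Measure.dirac (y i)) P.toMeasure ≤ _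
      rw [hPw]
      refine (OTDiscrepancy_sum_dirac_le hc w y _).trans ?_
      have h1 : ∀ i, c (y i) (Sum.elim x x i) =
          ENNReal.ofReal (c (y i) (Sum.elim x x i)).toReal := by
        rintro (i | i)
        exacts [(ENNReal.ofReal_toReal (hz i)).symm, (ENNReal.ofReal_toReal (hz' i)).symm]
      rw [Finset.sum_congr rfl fun i _ => by rw [h1 i, ← ENNReal.ofReal_mul (hw i)],
        ← ENNReal.ofReal_sum_of_nonneg fun i _ => mul_nonneg (hw i) ENNReal.toReal_nonneg]
      refine ENNReal.ofReal_le_ofReal (le_trans (le_of_eq ?_) hcost)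
      simp only [w, y, G, Fintype.sum_sum_type, Sum.elim_inl, Sum.elim_inr, Finset.mul_sum,
        mul_assoc]
    have h2 := hv Q hQ
    change eint (∑ i, ENNReal.ofReal (w i) • Measure.dirac (y i)) _ ≤ _ at h2
    rw [eint_sum_dirac hw hf, EReal.coe_le_coe_iff] at h2
    refine le_trans (le_of_eq ?_) h2
    simp only [w, y, F, Fintype.sum_sum_type, Sum.elim_inl, Sum.elim_inr, Finset.mul_sum,
      mul_assoc]
  obtain ⟨lam, hlam, h1⟩ := exists_multiplier_of_cross_nonneg (S := T) (g := fun z => G z - ε)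
    (h := fun z => v - F z)
    (fun z hz z' hz' hneg hpos => by
      have hts : 0 < G z' - G z := by linarith
      have h2 := hmix z hz z' hz' ((G z' - ε) / (G z' - G z)) ((ε - G z) / (G z' - G z))
        (div_nonneg hpos.le hts.le) (div_nonneg (by linarith) hts.le) (by field_simp; ring)
        (le_of_eq (by field_simp; ring))
      have h3 : (G z' - ε) / (G z' - G z) * F z + (ε - G z) / (G z' - G z) * F z' =
        ((G z' - ε) * F z + (ε - G z) * F z') / (G z' - G z) := by ring
      rw [h3, div_le_iff₀ hts] at h2
      linarith)
    (fun z hz hle => by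
      have := hmix z hz z hz 1 0 zero_le_one le_rfl (by ring) (by linarith)
      linarith)
    ⟨x, fun i => by simp [hc0], by simpa [G, hc0] using hε⟩
  obtain ⟨b, hb, hb'⟩ := exists_sum_le_of_forall_sum_le (S := fun i => {z | c z (x i) ≠ ⊤})
    (φ := fun i z => p i * (f z - lam * (c z (x i)).toReal)) (B := v - lam * ε)
    (fun i => ⟨x i, by simp [hc0]⟩)
    (fun z hz => by
      have h2 := h1 z hz
      have h3 : ∑ i, p i * (f (z i) - lam * (c (z i) (x i)).toReal) = F z - lam * G z := by
        simp only [F, G, Finset.mul_sum]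
        rw [← Finset.sum_sub_distrib]
        exact Finset.sum_congr rfl fun i _ => by ring
      rw [h3]
      linarith)
  refine ⟨lam, fun i => b i / p i, hlam, ?_, fun i z hz => ?_⟩
  · have h2 : ∀ i, p i * (b i / p i) = b i := fun i => mul_div_cancel₀ _ (hp i).ne'
    simp only [h2]
    linarith
  · rw [le_div_iff₀ (hp i), mul_comm]
    exact hb' i z hz

end Discrete

lemma convexE_coe_ennreal {n : ℕ} {g : (Fin n → ℝ) → ℝ≥0∞}
    (hg : ∀ x y : Fin n → ℝ, ∀ a b : ℝ, 0 ≤ a → 0 ≤ b → a + b = 1 →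
      g (a • x + b • y) ≤ ENNReal.ofReal a * g x + ENNReal.ofReal b * g y) :
    ConvexE (fun x => (g x : EReal)) := by
  intro x y a b ha hb hab
  have h := EReal.coe_ennreal_le_coe_ennreal_iff.2 (hg x y a b ha hb hab)
  rwa [EReal.coe_ennreal_add, EReal.coe_ennreal_mul, EReal.coe_ennreal_mul,
    EReal.coe_ennreal_ofReal, EReal.coe_ennreal_ofReal, max_eq_left ha, max_eq_left hb] at h

lemma measurable_iInf_fiber {α ι : Type*} [MeasurableSpace α] [MeasurableSingletonClass α]
    [Finite ι] (x : ι → α) (s : ι → ℝ) :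
    Measurable fun w => ⨅ i : {i // x i = w}, s i := by
  refine Measurable.measurable_of_countable_ne (f := fun _ => 0) measurable_const ?_
  refine (Set.finite_range x).countable.mono fun w hw => ?_
  by_contra hne
  have : IsEmpty {i // x i = w} := ⟨fun i => hne ⟨i, i.2⟩⟩
  exact hw (Real.iInf_of_isEmpty _).symm

lemma EReal.le_coe_of_forall_pos_le_add_mul {a : EReal} {A r : ℝ}
    (h : ∀ δ : ℝ, 0 < δ → a ≤ ((A + r * δ : ℝ) : EReal)) : a ≤ (A : EReal) := by
  induction a using EReal.rec with
  | bot => exact bot_le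
  | top => exact absurd (top_le_iff.1 (h 1 one_pos)) (EReal.coe_ne_top _)
  | coe a =>
    refine EReal.coe_le_coe_iff.2 (le_of_forall_pos_le_add fun η hη => ?_)
    have h1 := EReal.coe_le_coe_iff.1 (h (η / (|r| + 1)) (by positivity))
    have h2 : r * (η / (|r| + 1)) ≤ η := by
      rw [← mul_div_assoc, div_le_iff₀ (by positivity)]
      nlinarith [le_abs_self r]
    linarith

/-- **Primal reformulation of the DRO problem as a finite convex program.**
For a discrete reference distribution, a convex lower semicontinuous transportation cost,
a max-of-saddle-functions loss, convexly constrained support and feasible sets satisfying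
a Slater condition, and `ε > 0`, the primal DRO problem has the same infimum as the finite
convex program stated via conjugates and perspective functions. -/
theorem primal_reformulation {d m I J K L : ℕ}
    (hI : 0 < I) (hJ : 0 < J) (hK : 0 < K) (hL : 0 < L)
    -- constraint functions describing the support set and the feasible set
    (fk : Fin K → (Fin d → ℝ) → EReal)
    (hfk : ∀ k, ProperE (fk k) ∧ ConvexE (fk k) ∧ LowerSemicontinuous (fk k))
    (gl : Fin L → (Fin m → ℝ) → EReal)
    (hgl : ∀ l, ProperE (gl l) ∧ ConvexE (gl l) ∧ LowerSemicontinuous (gl l))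
    (𝒵 : Set (Fin d → ℝ)) (h𝒵 : 𝒵 = {z | ∀ k, fk k z ≤ 0})
    (Θ : Set (Fin m → ℝ)) (hΘ : Θ = {θ | ∀ l, gl l θ ≤ 0})
    -- transportation cost: lower semicontinuous in both arguments, convex in the first
    (c : (Fin d → ℝ) → (Fin d → ℝ) → ℝ≥0∞)
    (hc_id : ∀ z zhat, c z zhat = 0 ↔ z = zhat)
    (hc_lsc : LowerSemicontinuous (fun q : (Fin d → ℝ) × (Fin d → ℝ) => c q.1 q.2))
    (hc_conv : ∀ zhat z₁ z₂ : Fin d → ℝ, ∀ a b : ℝ, 0 ≤ a → 0 ≤ b → a + b = 1 →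
      c (a • z₁ + b • z₂) zhat ≤ ENNReal.ofReal a * c z₁ zhat + ENNReal.ofReal b * c z₂ zhat)
    -- the loss is a pointwise maximum of finitely many real-valued saddle functions
    (ℓi : Fin I → (Fin m → ℝ) → (Fin d → ℝ) → ℝ)
    (hℓθ : ∀ i (z : Fin d → ℝ), ConvexOn ℝ Set.univ (fun θ => ℓi i θ z) ∧
      LowerSemicontinuous (fun θ => ℓi i θ z))
    (hℓz : ∀ i (θ : Fin m → ℝ), ConcaveOn ℝ Set.univ (fun z => ℓi i θ z) ∧
      UpperSemicontinuous (fun z => ℓi i θ z))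
    -- discrete reference distribution
    (zhat : Fin J → (Fin d → ℝ)) (hzhat : ∀ j, zhat j ∈ 𝒵)
    (pj : Fin J → ℝ) (hpj : ∀ j, 0 < pj j) (hpsum : ∑ j, pj j = 1)
    (Phat : ProbabilityMeasure ↥𝒵)
    (hPhat : Phat.toMeasure =
      ∑ j, ENNReal.ofReal (pj j) • Measure.dirac (⟨zhat j, hzhat j⟩ : ↥𝒵))
    -- Slater condition at the atoms
    (hslater : ∀ j,
      zhat j ∈ intrinsicInterior ℝ {z | c z (zhat j) ≠ ⊤} ∧
      (∀ k, zhat j ∈ intrinsicInterior ℝ {z | fk k z ≠ ⊤}) ∧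
      (∀ k, ¬ (∃ (a : Fin d → ℝ) (b : ℝ), ∀ z, fk k z = ((dotp a z + b : ℝ) : EReal)) →
        fk k (zhat j) < 0))
    (ε : ℝ) (hε : 0 < ε) :
    (⨅ θ ∈ Θ, ⨆ Q ∈ ambiguitySet (fun z w : ↥𝒵 => c ↑z ↑w) Phat ε,
        eint Q.toMeasure (fun z : ↥𝒵 => ((⨆ i, ℓi i θ ↑z : ℝ) : EReal))) =
    sInf {v : EReal | ∃ (θ : Fin m → ℝ) (lam : ℝ) (s : Fin J → ℝ)
        (τ : Fin I → Fin J → Fin K → ℝ)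
        (ζl ζc : Fin I → Fin J → (Fin d → ℝ)) (ζf : Fin I → Fin J → Fin K → (Fin d → ℝ)),
      θ ∈ Θ ∧ 0 ≤ lam ∧ (∀ i j k, 0 ≤ τ i j k) ∧
      (∀ i j,
        (⨆ z : Fin d → ℝ, ((dotp (ζl i j) z + ℓi i θ z : ℝ) : EReal)) +
        perspE (fun ζ => ⨆ z : Fin d → ℝ,
          ((dotp ζ z : ℝ) : EReal) - ((c z (zhat j) : ℝ≥0∞) : EReal)) (ζc i j) lam +
        (∑ k, perspE (conjE (fk k)) (ζf i j k) (τ i j k)) ≤ ((s j : ℝ) : EReal)) ∧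
      (∀ i j, ζl i j + ζc i j + ∑ k, ζf i j k = 0) ∧
      v = ((lam * ε + ∑ j, pj j * s j : ℝ) : EReal)} := by
  have : Nonempty (Fin I) := ⟨⟨0, hI⟩⟩
  have hmem : ∀ z : ↥𝒵, ∀ k, fk k z ≤ 0 := fun z => h𝒵.subset z.2
  let x : Fin J → ↥𝒵 := fun j => ⟨zhat j, hzhat j⟩
  let C : Fin J → (Fin d → ℝ) → EReal := fun j z => (c z (zhat j) : EReal)
  have hcm : Measurable fun q : ↥𝒵 × ↥𝒵 => c q.1 q.2 := by
    have hval : Measurable fun q : ↥𝒵 × ↥𝒵 => ((q.1 : Fin d → ℝ), (q.2 : Fin d → ℝ)) := by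
      fun_prop
    exact hc_lsc.measurable.comp hval
  have hfm : ∀ θ, Measurable fun z : ↥𝒵 => ⨆ i, ℓi i θ z := fun θ =>
    Measurable.iSup fun i => (hℓz i θ).2.measurable.comp measurable_subtype_coe
  have hCtop : ∀ j z, C j z ≠ ⊤ ↔ c z (zhat j) ≠ ⊤ := fun j z => by simp [C]
  have hCreal : ∀ j z, (C j z).toReal = (c z (zhat j)).toReal := fun j z =>
    EReal.toReal_coe_ennreal
  refine le_antisymm (le_sInf ?_) (le_iInf₂ fun θ hθ => ?_)
  · rintro v ⟨θ, lam, s, τ, ζl, ζc, ζf, hθ, hlam, hτ, hs, hζ, rfl⟩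
    refine iInf₂_le_of_le θ hθ (iSup₂_le fun Q hQ => ?_)
    refine EReal.le_coe_of_forall_pos_le_add_mul (r := lam) fun δ hδ => ?_
    have hlt : OTDiscrepancy (fun z w : ↥𝒵 => c ↑z ↑w) Q.toMeasure Phat.toMeasure <
        ENNReal.ofReal (ε + δ) :=
      lt_of_le_of_lt hQ ((ENNReal.ofReal_lt_ofReal_iff (by linarith)).2 (by linarith))
    obtain ⟨π, hπ, hcost⟩ : ∃ π ∈ couplings Q.toMeasure Phat.toMeasure,
        ∫⁻ p, c p.1 p.2 ∂π < ENNReal.ofReal (ε + δ) := by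
      simpa only [OTDiscrepancy, iInf_lt_iff, exists_prop] using hlt
    let S : ↥𝒵 → ℝ := fun w => ⨅ j : {j // x j = w}, s j
    refine (eint_le_of_coupling (c := fun z w : ↥𝒵 => c ↑z ↑w) (e := ε + δ) (S := S)
      hπ hcm (fun j => (hpj j).le) hPhat
      (Set.finite_range x).measurableSet (hfm θ) (measurable_iInf_fiber x s) hlam
      (by linarith) hcost.le fun z j hz => ?_).trans (EReal.coe_le_coe_iff.2 ?_)
    · have : Nonempty {j' // x j' = x j} := ⟨⟨j, rfl⟩⟩
      rw [← sub_le_iff_le_add]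
      refine le_ciInf fun ⟨j', hj'⟩ => ?_
      rw [sub_le_iff_le_add]
      refine ciSup_le fun i => ?_
      have hj : zhat j' = zhat j := congrArg Subtype.val hj'
      have hz' : c z (zhat j) ≠ ⊤ := hz
      have h1 := le_of_conjugate_certificate (C := C j') (fun k => (hfk k).1) hlam
        (fun k => hτ i j' k) (hζ i j') (hs i j') (hmem z)
        ((hCtop j' z).2 (hj ▸ hz')) (EReal.coe_ennreal_ne_bot _)
      rw [hCreal, hj] at h1
      exact h1
    · have h1 : ∀ j, S (x j) ≤ s j := fun j =>
        ciInf_le (Set.finite_range fun i : {j' // x j' = x j} => s i).bddBelow ⟨j, rfl⟩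
      have h2 : ∑ j, pj j * S (x j) ≤ ∑ j, pj j * s j :=
        Finset.sum_le_sum fun j _ => mul_le_mul_of_nonneg_left (h1 j) (hpj j).le
      linarith
  · refine EReal.le_of_forall_lt_iff_le.1 fun v hv => ?_
    have hv' : ∀ Q ∈ ambiguitySet (fun z w : ↥𝒵 => c ↑z ↑w) Phat ε,
        eint Q.toMeasure (fun z : ↥𝒵 => ((⨆ i, ℓi i θ ↑z : ℝ) : EReal)) ≤ v := fun Q hQ =>
      (le_iSup₂ (f := fun Q (_ : Q ∈ ambiguitySet (fun z w : ↥𝒵 => c ↑z ↑w) Phat ε) =>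
        eint Q.toMeasure (fun z : ↥𝒵 => ((⨆ i, ℓi i θ ↑z : ℝ) : EReal))) Q hQ).trans hv.le
    obtain ⟨lam, s, hlam, hval, hs⟩ := exists_transport_price
      (c := fun z w : ↥𝒵 => c ↑z ↑w) (x := x) hcm
      (fun z => (hc_id z z).2 rfl) hpj hpsum hPhat hε (hfm θ) hv'
    have hcert := fun i j => exists_conjugate_certificate (fk := fk) (C := C j)
      (L := ℓi i θ) (x := zhat j) (lam := lam) (s := s j)
      (fun k => ⟨(hfk k).1, (hfk k).2.1⟩)
      ⟨fun z => EReal.coe_ennreal_ne_bot _, zhat j, by simp [C, (hc_id _ _).2]⟩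
      (convexE_coe_ennreal (hc_conv (zhat j))) (hℓz i θ).1
      (by
        simp only [hCtop]
        exact isRelCore_of_mem_intrinsicInterior (hslater j).1)
      (fun k => isRelCore_of_mem_intrinsicInterior ((hslater j).2.1 k))
      (hmem (x j)) ((hslater j).2.2) hlam
      (fun z hz hzk => by
        have hz𝒵 : z ∈ 𝒵 := by rw [h𝒵]; exact hzk
        have h1 := hs j ⟨z, hz𝒵⟩ ((hCtop j z).1 hz)
        have h2 : ℓi i θ z ≤ ⨆ i, ℓi i θ z :=
          le_ciSup (f := fun i => ℓi i θ z) (Set.finite_range _).bddAbove i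
        rw [hCreal]
        exact (sub_le_sub_right h2 _).trans h1)
    choose τ ζl ζc ζf hτ hζ hle using hcert
    refine sInf_le_of_le ⟨θ, lam, s, τ, ζl, ζc, ζf, hθ, hlam, hτ, hle, hζ, rfl⟩ ?_
    exact EReal.coe_le_coe_iff.2 hval
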